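/- Let A be a free arrangement, H ∈ A and A' := A \ {H}. Then (1) the projective dimension of D(A') over S is at most 1, and (2) D(A') is generated as an S-module by at most ℓ + 1 derivations. -/

import Mathlib

open MvPolynomial

noncomputable section

attribute [local instance] Classical.propDecidable

namespace ArrPOG

variable (K : Type) [Field K] (ℓ : ℕ)

/-- A polynomial vector field on `K^ℓ`: `θ = Σ θᵢ ∂/∂xᵢ`, identified with its
coefficient vector `(θ₁,…,θ_ℓ)` in `S = K[x₁,…,x_ℓ]`. -/
abbrev Deriv : Type := Fin ℓ → MvPolynomial (Fin ℓ) K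

variable {K ℓ}

/-- The linear polynomial `α_H ∈ S` associated to a linear form `φ ∈ V*`. -/
def linPoly (φ : Module.Dual K (Fin ℓ → K)) : MvPolynomial (Fin ℓ) K :=
  ∑ i, MvPolynomial.C (φ (Pi.single i 1)) * MvPolynomial.X i

/-- `θ(α)` for a derivation `θ` and the linear form `α` given by `φ ∈ V*`. -/
def applyLin (θ : Deriv K ℓ) (φ : Module.Dual K (Fin ℓ → K)) : MvPolynomial (Fin ℓ) K :=
  ∑ i, MvPolynomial.C (φ (Pi.single i 1)) * θ i

/-- An arrangement: a finite set of hyperplanes (kernels of nonzero linear forms). -/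
def IsArrangement (A : Finset (Submodule K (Fin ℓ → K))) : Prop :=
  ∀ H ∈ A, ∃ φ : Module.Dual K (Fin ℓ → K), φ ≠ 0 ∧ LinearMap.ker φ = H

/-- Essential: the common intersection of all members is `0`. -/
def Essential (A : Finset (Submodule K (Fin ℓ → K))) : Prop :=
  A.inf id = ⊥

/-- Membership in the logarithmic derivation module `D(A)`:
`θ(α_H) ∈ S·α_H` for every `H ∈ A`. -/
def InD (A : Finset (Submodule K (Fin ℓ → K))) (θ : Deriv K ℓ) : Prop :=
  ∀ H ∈ A, ∀ φ : Module.Dual K (Fin ℓ → K), LinearMap.ker φ = H → linPoly φ ∣ applyLin θ φ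

/-- A derivation is homogeneous of degree `n` if all its coefficients are. -/
def HomogDeriv (θ : Deriv K ℓ) (n : ℕ) : Prop := ∀ i, (θ i).IsHomogeneous n

/-- `θ₁,…,θₙ` generate `D(A)` as an `S`-module. -/
def GeneratesD {n : ℕ} (A : Finset (Submodule K (Fin ℓ → K))) (θ : Fin n → Deriv K ℓ) : Prop :=
  (∀ i, InD A (θ i)) ∧
    ∀ η, InD A η → ∃ c : Fin n → MvPolynomial (Fin ℓ) K, η = ∑ i, c i • θ i

/-- `S`-linear independence of a family of derivations. -/
def IndepD {n : ℕ} (θ : Fin n → Deriv K ℓ) : Prop :=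
  ∀ c : Fin n → MvPolynomial (Fin ℓ) K, (∑ i, c i • θ i) = 0 → ∀ i, c i = 0

/-- `A` is free with exponents `e`: `D(A)` has a homogeneous basis of degrees `e i`. -/
def IsFreeExp (A : Finset (Submodule K (Fin ℓ → K))) (e : Fin ℓ → ℕ) : Prop :=
  ∃ θ : Fin ℓ → Deriv K ℓ, (∀ i, HomogDeriv (θ i) (e i)) ∧ GeneratesD A θ ∧ IndepD θ

/-- `A` is free. -/
def IsFree (A : Finset (Submodule K (Fin ℓ → K))) : Prop := ∃ e, IsFreeExp A e

/-- `A` is plus-one generated with exponents `e`, level `lev`, realized by the minimal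
homogeneous generators `θ₁,…,θ_ℓ, φ` whose unique syzygy is `Σ fᵢ•θᵢ + α•φ = 0`:
this encodes the minimal free resolution
`0 → S[-lev-1] → S[-lev] ⊕ (⊕ S[-eᵢ]) → D(A) → 0`. -/
def IsPOGWith (A : Finset (Submodule K (Fin ℓ → K))) (e : Fin ℓ → ℕ) (lev : ℕ)
    (θ : Fin ℓ → Deriv K ℓ) (φ : Deriv K ℓ)
    (f : Fin ℓ → MvPolynomial (Fin ℓ) K) (α : MvPolynomial (Fin ℓ) K) : Prop :=
  (∀ i, InD A (θ i)) ∧ InD A φ ∧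
  (∀ i, HomogDeriv (θ i) (e i)) ∧ HomogDeriv φ lev ∧
  (∀ η, InD A η → ∃ (c : Fin ℓ → MvPolynomial (Fin ℓ) K) (g : MvPolynomial (Fin ℓ) K),
      η = (∑ i, c i • θ i) + g • φ) ∧
  α.IsHomogeneous 1 ∧
  (∀ i, (f i).IsHomogeneous (lev + 1 - e i)) ∧
  (∀ i, MvPolynomial.constantCoeff (f i) = 0) ∧
  ((∑ i, f i • θ i) + α • φ = 0) ∧
  (¬ (α = 0 ∧ ∀ i, f i = 0)) ∧
  (∀ (g : Fin ℓ → MvPolynomial (Fin ℓ) K) (h : MvPolynomial (Fin ℓ) K),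
      ((∑ i, g i • θ i) + h • φ = 0) →
      ∃ q : MvPolynomial (Fin ℓ) K, (∀ i, g i = q * f i) ∧ h = q * α)

/-- Plus-one generated with exponents `e` and level `lev`. -/
def IsPOG (A : Finset (Submodule K (Fin ℓ → K))) (e : Fin ℓ → ℕ) (lev : ℕ) : Prop :=
  ∃ θ φ f α, IsPOGWith A e lev θ φ f α

/-- Strictly plus-one generated: the level coefficient `α` is nonzero. -/
def IsSPOG (A : Finset (Submodule K (Fin ℓ → K))) (e : Fin ℓ → ℕ) (lev : ℕ) : Prop :=
  ∃ θ φ f α, IsPOGWith A e lev θ φ f α ∧ α ≠ 0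

/-- The restriction `A^H = {L ⊓ H | L ∈ A \ {H}}`. -/
def restrict (A : Finset (Submodule K (Fin ℓ → K))) (H : Submodule K (Fin ℓ → K)) :
    Finset (Submodule K (Fin ℓ → K)) :=
  (A.erase H).image (fun L => L ⊓ H)

/-- The localization `A_X = {L ∈ A | X ⊆ L}`. -/
def localize (A : Finset (Submodule K (Fin ℓ → K))) (X : Submodule K (Fin ℓ → K)) :
    Finset (Submodule K (Fin ℓ → K)) :=
  A.filter (fun L => X ≤ L)

/-- The intersection lattice of `A`, inside the ambient space `T`. -/
def latticeOf (T : Submodule K (Fin ℓ → K)) (A : Finset (Submodule K (Fin ℓ → K))) :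
    Finset (Submodule K (Fin ℓ → K)) :=
  A.powerset.image (fun B => T ⊓ B.inf id)

/-- The Möbius function of the poset `L` (intersection lattice with top `T`). -/
def mob (T : Submodule K (Fin ℓ → K)) (L : Finset (Submodule K (Fin ℓ → K)))
    (X : Submodule K (Fin ℓ → K)) : ℤ :=
  if X = T then 1
  else - ∑ Y ∈ (L.filter fun Z => X < Z).attach, mob T L Y.1
termination_by (L.filter fun Z => X < Z).card
decreasing_by
  obtain ⟨Y, hY⟩ := Y
  simp only [Finset.mem_filter] at hY
  apply Finset.card_lt_card
  rw [Finset.ssubset_def]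
  constructor
  · intro Z hZ
    simp only [Finset.mem_filter] at hZ ⊢
    exact ⟨hZ.1, lt_trans hY.2 hZ.2⟩
  · intro hsub
    have h2 := hsub (Finset.mem_filter.mpr ⟨hY.1, hY.2⟩)
    simp only [Finset.mem_filter] at h2
    exact lt_irrefl Y h2.2

/-- The characteristic polynomial `χ(A;t) = Σ_{X ∈ L(A)} μ(X) t^{dim X}`
of an arrangement inside the ambient space `T`. -/
def charPoly (T : Submodule K (Fin ℓ → K)) (A : Finset (Submodule K (Fin ℓ → K))) :
    Polynomial ℤ :=
  ∑ X ∈ latticeOf T A,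
    Polynomial.C (mob T (latticeOf T A) X) * Polynomial.X ^ (Module.finrank K X)

/-- The Betti number `b_i(A)`: `χ(A;t) = Σ (-1)^i b_i(A) t^{ℓ-i}`. -/
def bNum (A : Finset (Submodule K (Fin ℓ → K))) (i : ℕ) : ℤ :=
  (-1) ^ i * (charPoly (⊤ : Submodule K (Fin ℓ → K)) A).coeff (ℓ - i)

/-- Evaluation of the Poincaré polynomial `π(A;t) = Σ μ(X) (-t)^{codim X}` at `t : ℚ`. -/
def poincareEval (A : Finset (Submodule K (Fin ℓ → K))) (t : ℚ) : ℚ :=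
  ∑ X ∈ latticeOf ⊤ A,
    (mob (⊤ : Submodule K (Fin ℓ → K)) (latticeOf ⊤ A) X : ℚ) *
      (-t) ^ (ℓ - Module.finrank K X)

/-- The Euler derivation `θ_E = Σ xᵢ ∂/∂xᵢ`. -/
def eulerD : Deriv K ℓ := fun i => MvPolynomial.X i

/-- `A` is locally free: `A_X` is free for every `X ∈ L(A)` other than `∩_{H∈A} H`. -/
def LocallyFree (A : Finset (Submodule K (Fin ℓ → K))) : Prop :=
  ∀ X ∈ latticeOf ⊤ A, X ≠ A.inf id → IsFree (localize A X)

/-- Transport a finite set of subspaces contained in `T` to `K^m` along a linear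
isomorphism `T ≃ K^m`. -/
def transport {m : ℕ} (T : Submodule K (Fin ℓ → K)) (eqv : T ≃ₗ[K] (Fin m → K))
    (A : Finset (Submodule K (Fin ℓ → K))) : Finset (Submodule K (Fin m → K)) :=
  A.image fun L => (L.comap T.subtype).map eqv.toLinearMap

/-- An arrangement inside the subspace `T` is free with exponents `e`, i.e. it is free
after identifying `T` with a coordinate space. -/
def RestrFreeExp {m : ℕ} (T : Submodule K (Fin ℓ → K))
    (A : Finset (Submodule K (Fin ℓ → K))) (e : Fin m → ℕ) : Prop :=
  ∃ eqv : T ≃ₗ[K] (Fin m → K), IsFreeExp (transport T eqv A) e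

/-- The multiset of exponents. -/
def expMS {n : ℕ} (e : Fin n → ℕ) : Multiset ℕ := Finset.univ.val.map e

/-- `D(A)` has projective dimension at most 1: some finite generating set has a free
(possibly zero) syzygy module, i.e. there is a free resolution
`0 → S^m → S^n → D(A) → 0`. -/
def PdimLEOne (A : Finset (Submodule K (Fin ℓ → K))) : Prop :=
  ∃ (n m : ℕ) (θ : Fin n → Deriv K ℓ) (r : Fin m → Fin n → MvPolynomial (Fin ℓ) K),
    GeneratesD A θ ∧
    (∀ j, (∑ i, r j i • θ i) = 0) ∧
    (∀ c : Fin n → MvPolynomial (Fin ℓ) K, (∑ i, c i • θ i) = 0 →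
      ∃ q : Fin m → MvPolynomial (Fin ℓ) K, ∀ i, c i = ∑ j, q j * r j i) ∧
    (∀ q : Fin m → MvPolynomial (Fin ℓ) K, (∀ i, (∑ j, q j * r j i) = 0) → ∀ j, q j = 0)

/-- `A` has a free filtration `∅ = A₀ ⊂ A₁ ⊂ ⋯ ⊂ A_n = A`, `|A_i| = i`, each `A_i` free. -/
def HasFreeFiltration (A : Finset (Submodule K (Fin ℓ → K))) : Prop :=
  ∃ c : ℕ → Finset (Submodule K (Fin ℓ → K)),
    c A.card = A ∧ (∀ i ≤ A.card, (c i).card = i ∧ IsFree (c i)) ∧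
    ∀ i < A.card, c i ⊆ c (i + 1)

/-- The intersection lattices of `A` and `B` are isomorphic: there is a bijection of
hyperplanes preserving the rank of every subset (equivalently, a lattice isomorphism). -/
def LatticeEquiv (A B : Finset (Submodule K (Fin ℓ → K))) : Prop :=
  ∃ σ : Submodule K (Fin ℓ → K) → Submodule K (Fin ℓ → K),
    Set.BijOn σ ↑A ↑B ∧
    ∀ T ⊆ A, Module.finrank K ((T.inf id : Submodule K (Fin ℓ → K))) =
      Module.finrank K (((T.image σ).inf id : Submodule K (Fin ℓ → K)))


lemma applyLin_add (θ η : Deriv K ℓ) (φ : Module.Dual K (Fin ℓ → K)) :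
    applyLin (θ + η) φ = applyLin θ φ + applyLin η φ := by
  simp [applyLin, mul_add, Finset.sum_add_distrib]

lemma applyLin_sub (θ η : Deriv K ℓ) (φ : Module.Dual K (Fin ℓ → K)) :
    applyLin (θ - η) φ = applyLin θ φ - applyLin η φ := by
  simp [applyLin, mul_sub, Finset.sum_sub_distrib]

lemma applyLin_smul (c : MvPolynomial (Fin ℓ) K) (θ : Deriv K ℓ)
    (φ : Module.Dual K (Fin ℓ → K)) :
    applyLin (c • θ) φ = c * applyLin θ φ := by
  simp only [applyLin, Finset.mul_sum, Pi.smul_apply, smul_eq_mul]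
  exact Finset.sum_congr rfl fun i _ => by ring

lemma inD_add {A : Finset (Submodule K (Fin ℓ → K))} {θ η : Deriv K ℓ}
    (h1 : InD A θ) (h2 : InD A η) : InD A (θ + η) := fun H hH φ hφ => by
  rw [applyLin_add]; exact dvd_add (h1 H hH φ hφ) (h2 H hH φ hφ)

lemma inD_sub {A : Finset (Submodule K (Fin ℓ → K))} {θ η : Deriv K ℓ}
    (h1 : InD A θ) (h2 : InD A η) : InD A (θ - η) := fun H hH φ hφ => by
  rw [applyLin_sub]; exact dvd_sub (h1 H hH φ hφ) (h2 H hH φ hφ)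

lemma inD_smul {A : Finset (Submodule K (Fin ℓ → K))} {θ : Deriv K ℓ}
    (c : MvPolynomial (Fin ℓ) K) (h1 : InD A θ) : InD A (c • θ) := fun H hH φ hφ => by
  rw [applyLin_smul]; exact Dvd.dvd.mul_left (h1 H hH φ hφ) c

lemma inD_zero {A : Finset (Submodule K (Fin ℓ → K))} : InD A (0 : Deriv K ℓ) :=
  fun H hH φ hφ => by simp [applyLin]

lemma inD_sum {n : ℕ} {A : Finset (Submodule K (Fin ℓ → K))} {θ : Fin n → Deriv K ℓ}
    (c : Fin n → MvPolynomial (Fin ℓ) K) (h1 : ∀ i, InD A (θ i)) :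
    InD A (∑ i, c i • θ i) :=
  Finset.sum_induction _ (InD A) (fun _ _ => inD_add) inD_zero
    fun i _ => inD_smul _ (h1 i)

lemma eval_linPoly (φ : Module.Dual K (Fin ℓ → K)) (v : Fin ℓ → K) :
    MvPolynomial.eval v (linPoly φ) = φ v := by
  conv_rhs => rw [LinearMap.pi_apply_eq_sum_univ φ v]
  simp only [linPoly, map_sum, map_mul, eval_C, eval_X, smul_eq_mul]
  refine Finset.sum_congr rfl fun i _ => ?_
  rw [mul_comm]
  congr 2
  ext j
  simp [Pi.single_apply, eq_comm]

lemma exists_quot (φ : Module.Dual K (Fin ℓ → K)) (hφ : φ ≠ 0) :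
    ∃ (j : Fin ℓ) (π : MvPolynomial (Fin ℓ) K →ₐ[K] MvPolynomial {i : Fin ℓ // i ≠ j} K),
      Function.Surjective π ∧ ∀ f, linPoly φ ∣ f ↔ π f = 0 := by
  have hj : ∃ j, φ (Pi.single j 1) ≠ 0 := by
    by_contra! h
    apply hφ
    apply LinearMap.pi_ext'
    intro i
    ext
    simpa using h i
  obtain ⟨j, hj⟩ := hj
  set a : Fin ℓ → K := fun i => φ (Pi.single i 1) with ha
  let π : MvPolynomial (Fin ℓ) K →ₐ[K] MvPolynomial {i : Fin ℓ // i ≠ j} K :=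
    aeval fun i => if h : i = j then
      - C (a j)⁻¹ * ∑ k : {i : Fin ℓ // i ≠ j}, C (a k.1) * X k else X ⟨i, h⟩
  let σ : MvPolynomial {i : Fin ℓ // i ≠ j} K →ₐ[K] MvPolynomial (Fin ℓ) K := rename Subtype.val
  have hsplit : linPoly φ = C (a j) * X j + ∑ k : {i : Fin ℓ // i ≠ j}, C (a k.1) * X k.1 := by
    rw [linPoly, ← Finset.add_sum_erase _ _ (Finset.mem_univ j)]
    congr 1
    refine (Finset.sum_subtype (p := fun i => i ≠ j) _ (by simp)
      (fun i => C (a i) * (X i : MvPolynomial (Fin ℓ) K)))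
  have hπσ : ∀ g, π (σ g) = g := by
    intro g
    have : π.comp σ = AlgHom.id K _ := by
      ext1 k
      simp [π, σ, k.2]
    exact DFunLike.congr_fun this g
  have hC : (C (a j) : MvPolynomial {i : Fin ℓ // i ≠ j} K) * C (a j)⁻¹ = 1 := by
    rw [← C_mul, mul_inv_cancel₀ hj, C_1]
  have hC' : (C (a j) : MvPolynomial (Fin ℓ) K) * C (a j)⁻¹ = 1 := by
    rw [← C_mul, mul_inv_cancel₀ hj, C_1]
  have hXj : π (X j) = - C (a j)⁻¹ * ∑ k : {i : Fin ℓ // i ≠ j}, C (a k.1) * X k := by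
    simp [π]
  have hXk : ∀ k : {i : Fin ℓ // i ≠ j}, π (X k.1) = X k := by
    intro k
    simp [π, k.2]
  have hCπ : ∀ c, π (C c) = C c := fun c => by simp [π]
  have hα : π (linPoly φ) = 0 := by
    rw [hsplit]
    simp only [map_add, map_mul, map_sum, hCπ, hXj, hXk]
    linear_combination (- ∑ k : {i : Fin ℓ // i ≠ j}, C (a k.1) * X k) * hC
  have hmod : ∀ f, linPoly φ ∣ f - σ (π f) := by
    intro f
    have h : (Ideal.Quotient.mkₐ K (Ideal.span {linPoly φ})).comp (σ.comp π) =
        Ideal.Quotient.mkₐ K (Ideal.span {linPoly φ}) := by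
      ext1 i
      simp only [AlgHom.comp_apply, Ideal.Quotient.mkₐ_eq_mk]
      rw [Ideal.Quotient.eq, Ideal.mem_span_singleton]
      by_cases hi : i = j
      · subst hi
        rw [hXj, hsplit]
        refine ⟨- C (a i)⁻¹, ?_⟩
        have hs : ∀ c, σ (C c) = C c := fun c => by simp [σ]
        have hx : ∀ k, σ (X k) = X k.1 := fun k => by simp [σ]
        simp only [map_neg, map_mul, map_sum, hs, hx]
        linear_combination (X i) * hC'
      · rw [hXk ⟨i, hi⟩]
        simp [σ]
    have := DFunLike.congr_fun h f
    simp only [AlgHom.comp_apply, Ideal.Quotient.mkₐ_eq_mk] at this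
    rw [eq_comm, Ideal.Quotient.eq, Ideal.mem_span_singleton] at this
    exact this
  refine ⟨j, π, fun g => ⟨σ g, hπσ g⟩, fun f => ⟨?_, ?_⟩⟩
  · rintro ⟨g, rfl⟩
    rw [map_mul, hα, zero_mul]
  · intro h
    have := hmod f
    rwa [h, map_zero, sub_zero] at this

lemma exists_smul_of_ker_eq {φ ψ : Module.Dual K (Fin ℓ → K)}
    (h : LinearMap.ker φ ≤ LinearMap.ker ψ) : ∃ c : K, ψ = c • φ := by
  by_cases hφ : φ = 0
  · subst hφ
    refine ⟨0, ?_⟩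
    ext1 i
    ext
    have : Pi.single i 1 ∈ LinearMap.ker ψ := h (by simp)
    simpa using this
  · obtain ⟨v, hv⟩ : ∃ v, φ v ≠ 0 := by
      by_contra! hh
      exact hφ (LinearMap.ext hh)
    refine ⟨ψ v / φ v, LinearMap.ext fun w => ?_⟩
    have : w - (φ w / φ v) • v ∈ LinearMap.ker ψ := h (by simp [hv])
    rw [LinearMap.mem_ker, map_sub, map_smul, sub_eq_zero] at this
    rw [this]
    simp only [smul_eq_mul, LinearMap.smul_apply]
    field_simp

lemma linPoly_smul (c : K) (φ : Module.Dual K (Fin ℓ → K)) :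
    linPoly (c • φ) = C c * linPoly φ := by
  simp [linPoly, Finset.mul_sum, mul_assoc]

lemma applyLin_smul_right (c : K) (θ : Deriv K ℓ) (φ : Module.Dual K (Fin ℓ → K)) :
    applyLin θ (c • φ) = C c * applyLin θ φ := by
  simp [applyLin, Finset.mul_sum, mul_assoc]

lemma inD_of_erase {A : Finset (Submodule K (Fin ℓ → K))} {H : Submodule K (Fin ℓ → K)}
    {φ : Module.Dual K (Fin ℓ → K)} (hφ : LinearMap.ker φ = H)
    {η : Deriv K ℓ} (h : InD (A.erase H) η) (hd : linPoly φ ∣ applyLin η φ) : InD A η := by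
  intro L hL ψ hψ
  by_cases hLH : L = H
  · obtain ⟨c, hc⟩ := exists_smul_of_ker_eq (φ := φ) (ψ := ψ) (by rw [hφ, hψ, hLH])
    subst hc
    rw [linPoly_smul, applyLin_smul_right]
    exact mul_dvd_mul_left _ hd
  · exact h L (Finset.mem_erase.2 ⟨hLH, hL⟩) ψ hψ

lemma inD_erase {A : Finset (Submodule K (Fin ℓ → K))} {H : Submodule K (Fin ℓ → K)}
    {η : Deriv K ℓ} (h : InD A η) : InD (A.erase H) η :=
  fun L hL => h L (Finset.mem_of_mem_erase hL)

lemma inD_erase_of_mul {A : Finset (Submodule K (Fin ℓ → K))} (hA : IsArrangement A)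
    {H : Submodule K (Fin ℓ → K)}
    {φ : Module.Dual K (Fin ℓ → K)} (hφ0 : φ ≠ 0) (hφ : LinearMap.ker φ = H)
    {η : Deriv K ℓ} (h : InD (A.erase H) (linPoly φ • η)) : InD (A.erase H) η := by
  intro L hL ψ hψ
  have h1 := h L hL ψ hψ
  obtain ⟨hLH, hLA⟩ := Finset.mem_erase.1 hL
  have hψ0 : ψ ≠ 0 := by
    rintro rfl
    obtain ⟨χ, hχ0, hχ⟩ := hA L hLA
    apply hχ0
    rw [← LinearMap.ker_eq_top, hχ, ← hψ, LinearMap.ker_zero]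
  obtain ⟨j, π, -, hπ⟩ := exists_quot ψ hψ0
  rw [applyLin_smul, hπ, map_mul, mul_eq_zero, ← hπ, ← hπ] at h1
  refine h1.resolve_left ?_
  intro hd
  have hle : LinearMap.ker ψ ≤ LinearMap.ker φ := by
    intro v hv
    rw [LinearMap.mem_ker] at hv ⊢
    obtain ⟨g, hg⟩ := hd
    rw [← eval_linPoly, hg, map_mul, eval_linPoly, hv, zero_mul]
  obtain ⟨c, hc⟩ := exists_smul_of_ker_eq hle
  have hc0 : c ≠ 0 := by
    rintro rfl
    exact hφ0 (by simpa using hc)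
  apply hLH
  rw [← hψ, ← hφ, hc, LinearMap.ker_smul _ _ hc0]

/-- Corollary `cors`: for `A` free and `H ∈ A`, the deletion
`A' = A \ {H}` satisfies (1) `pd_S D(A') ≤ 1` and (2) `D(A')` is generated by at most
`ℓ + 1` derivations. -/
theorem deletion_pd_le_one_and_gens {K : Type} [Field K] {ℓ : ℕ}
    (A : Finset (Submodule K (Fin ℓ → K)))
    (hA : IsArrangement A) (hEss : Essential A) (hfree : IsFree A)
    (H : Submodule K (Fin ℓ → K)) (hH : H ∈ A) :
    PdimLEOne (A.erase H) ∧
      ∃ θ : Fin (ℓ + 1) → Deriv K ℓ, GeneratesD (A.erase H) θ := by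
  obtain ⟨e, θ, -, ⟨hθD, hgen⟩, hind⟩ := hfree
  obtain ⟨φ, hφ0, hφ⟩ := hA H hH
  obtain ⟨j, π, hsurj, hπ⟩ := exists_quot φ hφ0
  set α := linPoly φ with hαdef
  have hπα : π α = 0 := (hπ α).1 dvd_rfl
  have hα0 : α ≠ 0 := by
    intro h0
    apply hφ0
    ext1 i
    ext
    have := eval_linPoly φ (Pi.single i 1)
    rw [← hαdef, h0, map_zero] at this
    simpa using this.symm
  have hθD' : ∀ i, InD (A.erase H) (θ i) := fun i => inD_erase (hθD i)
  have hin : ∀ {η}, InD (A.erase H) η → π (applyLin η φ) = 0 → InD A η :=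
    fun h1 h2 => inD_of_erase hφ h1 ((hπ _).2 h2)
  have hout : ∀ {η}, InD A η → π (applyLin η φ) = 0 := fun h => (hπ _).1 (h H hH φ hφ)
  have hαη : ∀ {η}, InD (A.erase H) η → InD A (α • η) := fun h =>
    hin (inD_smul _ h) (by rw [applyLin_smul, map_mul, hπα, zero_mul])
  have huniq : ∀ c d : Fin ℓ → MvPolynomial (Fin ℓ) K,
      ∑ i, c i • θ i = ∑ i, d i • θ i → ∀ i, c i = d i := by
    intro c d h i
    have := hind (fun i => c i - d i) (by
      simp only [sub_smul, Finset.sum_sub_distrib, h, sub_self]) i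
    exact sub_eq_zero.1 this
  have hcancel : ∀ {η ζ : Deriv K ℓ}, α • η = α • ζ → η = ζ := by
    intro η ζ h
    funext k
    exact mul_left_cancel₀ hα0 (congrFun h k)
  by_cases hMN : ∀ η, InD (A.erase H) η → InD A η
  · refine ⟨⟨ℓ, 0, θ, fun j => j.elim0, ⟨hθD', fun η h => hgen η (hMN η h)⟩,
      fun j => j.elim0, fun c hc => ⟨fun j => j.elim0, fun i => ?_⟩, fun q _ j => j.elim0⟩,
      Fin.cons 0 θ, ?_, ?_⟩
    · simpa using hind c hc i
    · intro i
      refine Fin.cases ?_ (fun i => ?_) i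
      · exact inD_zero
      · exact hθD' i
    · intro η h
      obtain ⟨c, hc⟩ := hgen η (hMN η h)
      exact ⟨Fin.cons 0 c, by simpa [Fin.sum_univ_succ] using hc⟩
  push Not at hMN
  obtain ⟨η₀, hη₀, hη₀A⟩ := hMN
  obtain ⟨c, hc⟩ := hgen _ (hαη hη₀)
  let _ : NormalizedGCDMonoid (MvPolynomial {i : Fin ℓ // i ≠ j} K) :=
    Classical.choice inferInstance
  have hne : ∃ i, π (c i) ≠ 0 := by
    by_contra! h0
    choose d hd using fun i => (hπ (c i)).2 (h0 i)
    apply hη₀A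
    have : η₀ = ∑ i, d i • θ i := by
      apply hcancel
      rw [hc, Finset.smul_sum]
      exact Finset.sum_congr rfl fun i _ => by rw [hd i, mul_smul]
    rw [this]
    exact inD_sum _ hθD
  obtain ⟨i₀, hi₀⟩ := hne
  obtain ⟨z, hz, hz1⟩ := Finset.extract_gcd (s := (Finset.univ : Finset (Fin ℓ)))
    (fun i => π (c i)) ⟨i₀, Finset.mem_univ _⟩
  set g := Finset.univ.gcd (fun i => π (c i)) with hg
  have hg0 : g ≠ 0 := by
    intro h
    apply hi₀
    rw [hz i₀ (Finset.mem_univ _), h, zero_mul]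
  choose c₀ hc₀ using fun i => hsurj (z i)
  have hdiv : ∀ k, α ∣ (∑ i, c₀ i • θ i) k := by
    intro k
    rw [hπ]
    apply mul_left_cancel₀ hg0
    rw [mul_zero]
    have h1 := congrArg π (congrFun hc k)
    simp only [Pi.smul_apply, smul_eq_mul, map_mul, hπα, zero_mul, Finset.sum_apply,
      map_sum] at h1
    simp only [Pi.smul_apply, smul_eq_mul, map_mul, Finset.sum_apply, map_sum,
      Finset.mul_sum, hc₀]
    rw [h1]
    exact Finset.sum_congr rfl fun i _ => by rw [hz i (Finset.mem_univ _), mul_assoc]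
  choose ψ hψ' using hdiv
  have hψ : ∑ i, c₀ i • θ i = α • ψ := funext hψ'
  have hψD : InD (A.erase H) ψ := by
    apply inD_erase_of_mul hA hφ0 hφ
    rw [← hαdef, ← hψ]
    exact inD_sum _ hθD'
  have ha0 : π (applyLin ψ φ) ≠ 0 := by
    intro h
    obtain ⟨d, hd⟩ := hgen _ (hin hψD h)
    have h2 := huniq c₀ (fun i => α * d i) (by
      rw [hψ, hd, Finset.smul_sum]
      exact Finset.sum_congr rfl fun i _ => by rw [mul_smul])
    apply hi₀
    rw [hz i₀ (Finset.mem_univ _), ← hc₀, h2, map_mul, hπα, zero_mul, mul_zero]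
  have hkey : ∀ η, InD (A.erase H) η → ∃ (q : MvPolynomial (Fin ℓ) K)
      (d : Fin ℓ → MvPolynomial (Fin ℓ) K), η = q • ψ + ∑ i, d i • θ i := by
    intro η hη
    obtain ⟨u, hu⟩ := hgen _ (hαη hη)
    have h1 : InD A (applyLin η φ • ψ - applyLin ψ φ • η) := by
      apply hin (inD_sub (inD_smul _ hψD) (inD_smul _ hη))
      rw [applyLin_sub, applyLin_smul, applyLin_smul, mul_comm, sub_self, map_zero]
    obtain ⟨d, hd⟩ := hgen _ h1
    have h2 := huniq (fun i => applyLin η φ * c₀ i - applyLin ψ φ * u i) (fun i => α * d i) (by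
      simp only [sub_smul, mul_smul, Finset.sum_sub_distrib, ← Finset.smul_sum]
      rw [hψ, ← hu, ← hd, smul_sub, smul_comm, smul_comm (applyLin ψ φ)])
    have h3 : ∀ i, π (applyLin ψ φ) ∣ π (applyLin η φ) * z i := by
      intro i
      have := congrArg π (h2 i)
      simp only [map_sub, map_mul, hπα, zero_mul, hc₀] at this
      exact ⟨π (u i), sub_eq_zero.1 this⟩
    have h4 : π (applyLin ψ φ) ∣ π (applyLin η φ) := by
      have h5 := Finset.dvd_gcd (s := Finset.univ) (f := fun i => π (applyLin η φ) * z i)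
        (fun i _ => h3 i)
      have h6 := h5.trans (Finset.gcd_mul_left' _ _ (π (applyLin η φ))).dvd
      rwa [hz1, mul_one] at h6
    obtain ⟨q', hq'⟩ := h4
    obtain ⟨q, rfl⟩ := hsurj q'
    obtain ⟨d, hd⟩ := hgen (η - q • ψ) (hin (inD_sub hη (inD_smul _ hψD)) (by
      rw [applyLin_sub, applyLin_smul, map_sub, map_mul, hq']; ring))
    exact ⟨q, d, by rw [← hd]; abel⟩
  have hG : GeneratesD (A.erase H) (Fin.cons ψ θ : Fin (ℓ + 1) → Deriv K ℓ) := by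
    refine ⟨fun i => ?_, fun η hη => ?_⟩
    · refine Fin.cases ?_ (fun i => ?_) i
      · exact hψD
      · exact hθD' i
    · obtain ⟨q, d, h⟩ := hkey η hη
      exact ⟨Fin.cons q d, by simpa [Fin.sum_univ_succ] using h⟩
  refine ⟨⟨ℓ + 1, 1, Fin.cons ψ θ, fun _ => Fin.cons α (fun i => - c₀ i), hG, ?_, ?_, ?_⟩,
    _, hG⟩
  · intro _
    simp [Fin.sum_univ_succ, hψ]
  · intro u hu
    simp only [Fin.sum_univ_succ, Fin.cons_zero, Fin.cons_succ] at hu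
    have h1 : u 0 • ψ = ∑ i : Fin ℓ, (- u i.succ) • θ i := by
      simp only [neg_smul, Finset.sum_neg_distrib]
      exact eq_neg_of_add_eq_zero_left hu
    have h2 : π (u 0) = 0 := by
      have h3 : InD A (u 0 • ψ) := by
        rw [h1]
        exact inD_sum _ hθD
      have h4 := hout h3
      rw [applyLin_smul, map_mul] at h4
      exact (mul_eq_zero.1 h4).resolve_right ha0
    obtain ⟨q, hq⟩ := (hπ _).2 h2
    have h5 := huniq (fun i => q * c₀ i) (fun i => - u i.succ) (by
      simp only [mul_smul, ← Finset.smul_sum]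
      rw [hψ, ← h1, hq, mul_comm, mul_smul])
    refine ⟨fun _ => q, fun i => ?_⟩
    refine Fin.cases ?_ (fun i => ?_) i
    · simp [hq, mul_comm]
    · have := h5 i
      simp [this]
  · intro q hq k
    have h := hq 0
    simp only [Finset.univ_unique, Finset.sum_singleton, Fin.cons_zero] at h
    rw [Subsingleton.elim k default]
    exact (mul_eq_zero.1 h).resolve_right hα0

end ArrPOG
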